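/- arXiv:0906.1856 — 2 statements merged into one kernel-verified Lean document; each statement's English description precedes it below -/
import Mathlib

section
/- For all 0 ≤ t₁ < t₂ < t₃ < ∞ the following identities hold: (i) p(t₁,t₂) + γ(t₂,t₃) = C(t₁,t₃) / (B(0,t₂)·C(t₁,t₂)·C(t₂,t₃)); (ii) p(t₁,t₂)·p(t₂,t₃) / (p(t₁,t₂) + γ(t₂,t₃)) = p(t₁,t₃); (iii) γ(t₁,t₂)·γ(t₂,t₃) / (p(t₁,t₂) + γ(t₂,t₃)) = γ(t₁,t₃). -/
open MeasureTheory Filter Set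

/-- `C(s,t) = ∫_s^t (σ²(v)/2)·exp(∫_0^v β(u)du) dv` -/
noncomputable def Cf (σ β : ℝ → ℝ) (s t : ℝ) : ℝ :=
  ∫ v in s..t, σ v ^ 2 / 2 * Real.exp (∫ u in (0:ℝ)..v, β u)

/-- `B(s,t) = exp(−∫_s^t β(v)dv)` -/
noncomputable def Bf (β : ℝ → ℝ) (s t : ℝ) : ℝ :=
  Real.exp (-∫ v in s..t, β v)

/-- `p(s,t) = 1/(B(0,t)·C(s,t))` -/
noncomputable def pf (σ β : ℝ → ℝ) (s t : ℝ) : ℝ :=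
  1 / (Bf β 0 t * Cf σ β s t)

/-- `γ(s,t) = 1/(B(0,s)·C(s,t))` -/
noncomputable def gf (σ β : ℝ → ℝ) (s t : ℝ) : ℝ :=
  1 / (Bf β 0 s * Cf σ β s t)

theorem continuousOn_Cf_integrand {σ β : ℝ → ℝ}
    (hσ : ContinuousOn σ (Set.Ici 0)) (hβ : ContinuousOn β (Set.Ici 0))
    {s t : ℝ} (hs : 0 ≤ s) (hst : s ≤ t) :
    ContinuousOn (fun v => σ v ^ 2 / 2 * Real.exp (∫ u in (0:ℝ)..v, β u)) (Set.uIcc s t) := by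
  have ht : 0 ≤ t := hs.trans hst
  have hprim : ContinuousOn (fun v => ∫ u in (0:ℝ)..v, β u) (Set.uIcc 0 t) := by
    refine intervalIntegral.continuousOn_primitive_interval ?_
    rw [Set.uIcc_of_le ht]
    exact (hβ.mono Set.Icc_subset_Ici_self).integrableOn_Icc
  rw [Set.uIcc_of_le ht] at hprim
  rw [Set.uIcc_of_le hst]
  exact (((hσ.mono fun x hx => hs.trans hx.1).pow 2).div_const 2).mul
    (hprim.mono (Set.Icc_subset_Icc_left hs)).rexp

theorem Cf_pos {σ β : ℝ → ℝ}
    (hσ : ContinuousOn σ (Set.Ici 0)) (hβ : ContinuousOn β (Set.Ici 0))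
    (hpos : ∀ x ∈ Set.Ici (0:ℝ), 0 < σ x) {s t : ℝ} (hs : 0 ≤ s) (hst : s < t) :
    0 < Cf σ β s t := by
  refine intervalIntegral.intervalIntegral_pos_of_pos_on
    (continuousOn_Cf_integrand hσ hβ hs hst.le).intervalIntegrable (fun x hx => ?_) hst
  have := hpos x (hs.trans hx.1.le)
  positivity

theorem Cf_add_Cf {σ β : ℝ → ℝ}
    (hσ : ContinuousOn σ (Set.Ici 0)) (hβ : ContinuousOn β (Set.Ici 0))
    {r s t : ℝ} (hr : 0 ≤ r) (hrs : r ≤ s) (hst : s ≤ t) :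
    Cf σ β r s + Cf σ β s t = Cf σ β r t :=
  intervalIntegral.integral_add_adjacent_intervals
    (continuousOn_Cf_integrand hσ hβ hr hrs).intervalIntegrable
    (continuousOn_Cf_integrand hσ hβ (hr.trans hrs) hst).intervalIntegrable

/-- Identities: `p(t₁,t₂) + γ(t₂,t₃) = C(t₁,t₃)/(B(0,t₂)·C(t₁,t₂)·C(t₂,t₃))`,
`p(t₁,t₂)·p(t₂,t₃)/(p(t₁,t₂)+γ(t₂,t₃)) = p(t₁,t₃)` and
`γ(t₁,t₂)·γ(t₂,t₃)/(p(t₁,t₂)+γ(t₂,t₃)) = γ(t₁,t₃)`. -/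
theorem stmt_7 (σ β : ℝ → ℝ)
    (hσc : ContinuousOn σ (Set.Ici 0)) (hβc : ContinuousOn β (Set.Ici 0))
    (hσpos : ∀ x ∈ Set.Ici (0:ℝ), 0 < σ x) (hβnn : ∀ x ∈ Set.Ici (0:ℝ), 0 ≤ β x)
    (t₁ t₂ t₃ : ℝ) (h₁ : 0 ≤ t₁) (h₁₂ : t₁ < t₂) (h₂₃ : t₂ < t₃) :
    pf σ β t₁ t₂ + gf σ β t₂ t₃ =
        Cf σ β t₁ t₃ / (Bf β 0 t₂ * Cf σ β t₁ t₂ * Cf σ β t₂ t₃) ∧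
    pf σ β t₁ t₂ * pf σ β t₂ t₃ / (pf σ β t₁ t₂ + gf σ β t₂ t₃) = pf σ β t₁ t₃ ∧
    gf σ β t₁ t₂ * gf σ β t₂ t₃ / (pf σ β t₁ t₂ + gf σ β t₂ t₃) = gf σ β t₁ t₃ := by
  have h12 := (Cf_pos hσc hβc hσpos h₁ h₁₂).ne'
  have h23 := (Cf_pos hσc hβc hσpos (h₁.trans h₁₂.le) h₂₃).ne'
  have h13 := (Cf_pos hσc hβc hσpos h₁ (h₁₂.trans h₂₃)).ne'
  have hB (t : ℝ) : Bf β 0 t ≠ 0 := (Real.exp_pos _).ne'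
  have hB1 := hB t₁
  have hB2 := hB t₂
  have hB3 := hB t₃
  have key : pf σ β t₁ t₂ + gf σ β t₂ t₃ =
      Cf σ β t₁ t₃ / (Bf β 0 t₂ * Cf σ β t₁ t₂ * Cf σ β t₂ t₃) := by
    rw [← Cf_add_Cf hσc hβc h₁ h₁₂.le h₂₃.le, pf, gf]
    field_simp
    ring
  refine ⟨key, ?_, ?_⟩
  · rw [key, pf, pf, pf]
    field_simp
  · rw [key, gf, gf, gf]
    field_simp
end

section
/- Let α : [0,∞) → ℝ be nonnegative, right-continuous and bounded. Then for every 0 ≤ s < t < ∞ there exists a probability measure I_{s,t} on [0,∞) whose Laplace transform is ∫_{[0,∞)} e^{−λx} I_{s,t}(dx) = exp( − ∫_s^t (σ²(v)/2)·α(v)·Ψ_{v,t}(λ) dv ) for all λ ≥ 0. -/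
open MeasureTheory Filter Set

/-- `Ψ_{s,t}(λ) = γ(s,t)·λ/(p(s,t)+λ)` -/
noncomputable def Psi (σ β : ℝ → ℝ) (s t l : ℝ) : ℝ :=
  gf σ β s t * l / (pf σ β s t + l)

/-- The standard exponential distribution, characterised by its Laplace transform. -/
lemma exists_exponential_law :
    ∃ E : Measure ℝ, IsProbabilityMeasure E ∧ (∀ᵐ y ∂E, 0 ≤ y) ∧
      ∀ c : ℝ, 0 ≤ c → ∫ y, Real.exp (-(c * y)) ∂E = 1 / (1 + c) := by
  have hmeas : Measurable fun y : ℝ => ENNReal.ofReal (Real.exp (-y)) := by fun_prop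
  refine ⟨(volume.restrict (Ioi (0 : ℝ))).withDensity fun y => ENNReal.ofReal (Real.exp (-y)),
    ⟨?_⟩, ?_, fun c hc => ?_⟩
  · rw [withDensity_apply _ MeasurableSet.univ, Measure.restrict_univ,
      ← ofReal_integral_eq_lintegral_ofReal (integrableOn_exp_neg_Ioi 0)
        (ae_of_all _ fun y => (Real.exp_pos _).le), integral_exp_neg_Ioi_zero, ENNReal.ofReal_one]
  · refine (withDensity_absolutelyContinuous _ _).ae_le ?_
    exact (ae_restrict_mem measurableSet_Ioi).mono fun y hy => le_of_lt hy
  · rw [integral_withDensity_eq_integral_toReal_smul hmeas (by simp)]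
    have h : ∀ y : ℝ, (ENNReal.ofReal (Real.exp (-y))).toReal • Real.exp (-(c * y))
        = Real.exp (-(1 + c) * y) := fun y => by
      rw [ENNReal.toReal_ofReal (Real.exp_pos _).le, smul_eq_mul, ← Real.exp_add]
      ring_nf
    simp_rw [h]
    rw [integral_exp_mul_Ioi (by linarith)]
    rw [mul_zero, Real.exp_zero, neg_div_neg_eq]

/-- A measure on the half-line integrates `x ↦ exp (-(l * x))`. -/
lemma integrable_exp_neg_mul_of_nonneg {ν : Measure ℝ} [IsFiniteMeasure ν]
    (hν : ∀ᵐ x ∂ν, 0 ≤ x) {l : ℝ} (hl : 0 ≤ l) :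
    Integrable (fun x => Real.exp (-(l * x))) ν := by
  refine Integrable.of_bound (by fun_prop) 1 (hν.mono fun x hx => ?_)
  rw [Real.norm_of_nonneg (Real.exp_pos _).le, Real.exp_le_one_iff]
  nlinarith [mul_nonneg hl hx]

/-- Convolution powers of a finite measure. -/
noncomputable def convPow (ν : Measure ℝ) : ℕ → Measure ℝ
  | 0 => Measure.dirac 0
  | n + 1 => convPow ν n ∗ ν

instance isFiniteMeasure_convPow (ν : Measure ℝ) [IsFiniteMeasure ν] (n : ℕ) :
    IsFiniteMeasure (convPow ν n) := by
  induction n with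
  | zero => unfold convPow; infer_instance
  | succ n ih => unfold convPow Measure.conv; infer_instance

lemma ae_nonneg_convPow {ν : Measure ℝ} [IsFiniteMeasure ν] (hν : ∀ᵐ x ∂ν, 0 ≤ x) (n : ℕ) :
    ∀ᵐ x ∂(convPow ν n), 0 ≤ x := by
  induction n with
  | zero =>
    unfold convPow
    exact (ae_dirac_iff measurableSet_Ici).2 le_rfl
  | succ n ih =>
    unfold convPow Measure.conv
    refine (ae_map_iff (by fun_prop) measurableSet_Ici).2 ?_
    filter_upwards [Measure.quasiMeasurePreserving_fst.ae ih,
      Measure.quasiMeasurePreserving_snd.ae hν] with z h1 h2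
    exact add_nonneg h1 h2

lemma lintegral_exp_convPow (ν : Measure ℝ) [IsFiniteMeasure ν] (l : ℝ) (n : ℕ) :
    ∫⁻ x, ENNReal.ofReal (Real.exp (-(l * x))) ∂(convPow ν n)
      = (∫⁻ x, ENNReal.ofReal (Real.exp (-(l * x))) ∂ν) ^ n := by
  induction n with
  | zero => simp [convPow]
  | succ n ih =>
    have hm : Measurable fun x : ℝ => ENNReal.ofReal (Real.exp (-(l * x))) := by fun_prop
    rw [convPow, Measure.lintegral_conv hm, pow_succ, ← ih, ← lintegral_mul_const _ hm]
    refine lintegral_congr fun x => ?_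
    rw [← lintegral_const_mul _ hm]
    refine lintegral_congr fun y => ?_
    rw [← ENNReal.ofReal_mul (Real.exp_pos _).le, ← Real.exp_add]
    ring_nf

/-- Compound Poisson law with finite jump measure `ν` on the half-line. -/
lemma exists_compoundPoisson (ν : Measure ℝ) [IsFiniteMeasure ν] (hν : ∀ᵐ x ∂ν, 0 ≤ x) :
    ∃ I : Measure ℝ, IsProbabilityMeasure I ∧ (∀ᵐ x ∂I, 0 ≤ x) ∧
      ∀ l : ℝ, 0 ≤ l → ∫ x, Real.exp (-(l * x)) ∂I
        = Real.exp ((∫ x, Real.exp (-(l * x)) ∂ν) - ν.real univ) := by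
  set I : Measure ℝ := ENNReal.ofReal (Real.exp (-ν.real univ)) •
    Measure.sum fun n : ℕ => ENNReal.ofReal (1 / (n.factorial : ℝ)) • convPow ν n with hI
  have key : ∀ l : ℝ, 0 ≤ l → ∫⁻ x, ENNReal.ofReal (Real.exp (-(l * x))) ∂I
      = ENNReal.ofReal (Real.exp ((∫ x, Real.exp (-(l * x)) ∂ν) - ν.real univ)) := by
    intro l hl
    have h0 : 0 ≤ ∫ x, Real.exp (-(l * x)) ∂ν := integral_nonneg fun x => (Real.exp_pos _).le
    rw [hI, lintegral_smul_measure, lintegral_sum_measure]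
    simp_rw [lintegral_smul_measure, lintegral_exp_convPow, smul_eq_mul]
    rw [← ofReal_integral_eq_lintegral_ofReal (integrable_exp_neg_mul_of_nonneg hν hl)
      (ae_of_all _ fun y => (Real.exp_pos _).le)]
    set L := ∫ x, Real.exp (-(l * x)) ∂ν
    have h1 : ∀ n : ℕ, ENNReal.ofReal (1 / (n.factorial : ℝ)) * ENNReal.ofReal L ^ n
        = ENNReal.ofReal (L ^ n / (n.factorial : ℝ)) := fun n => by
      rw [← ENNReal.ofReal_pow h0, ← ENNReal.ofReal_mul (by positivity)]
      ring_nf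
    simp_rw [h1]
    rw [← ENNReal.ofReal_tsum_of_nonneg (fun n => by positivity) (Real.summable_pow_div_factorial L),
      ← ENNReal.ofReal_mul (Real.exp_pos _).le]
    have h2 : ∑' n : ℕ, L ^ n / (n.factorial : ℝ) = Real.exp L := by
      rw [Real.exp_eq_exp_ℝ, NormedSpace.exp_eq_tsum_div]
    rw [h2, ← Real.exp_add]
    ring_nf
  refine ⟨I, ⟨?_⟩, ?_, fun l hl => ?_⟩
  · simpa using key 0 le_rfl
  · refine Measure.ae_smul_measure ?_ _
    rw [Measure.ae_sum_iff]
    exact fun n => Measure.ae_smul_measure (ae_nonneg_convPow hν n) _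
  · rw [integral_eq_lintegral_of_nonneg_ae (ae_of_all _ fun y => (Real.exp_pos _).le)
      (by fun_prop), key l hl, ENNReal.toReal_ofReal (Real.exp_pos _).le]

/-- A mixture of exponential jump laws with intensity bounded away from the degenerate case. -/
lemma exists_law_of_le {Ω : Type*} [MeasurableSpace Ω] (m : Measure Ω) [IsFiniteMeasure m]
    {q : Ω → ℝ} (hq : Measurable q) {δ : ℝ} (hδ : 0 < δ) (hqδ : ∀ a, δ ≤ q a) :
    ∃ I : Measure ℝ, IsProbabilityMeasure I ∧ (∀ᵐ x ∂I, 0 ≤ x) ∧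
      ∀ l : ℝ, 0 ≤ l → ∫ x, Real.exp (-(l * x)) ∂I
        = Real.exp (-∫ a, l / (1 + l * q a) ∂m) := by
  obtain ⟨E, hE, hE0, hEl⟩ := exists_exponential_law
  have hq0 : ∀ a, 0 < q a := fun a => hδ.trans_le (hqδ a)
  have hwm : Measurable fun a => ENNReal.ofReal (1 / q a) := by fun_prop
  have hint : Integrable (fun a => 1 / q a) m := by
    refine Integrable.of_bound (hq.const_div 1).aestronglyMeasurable (1 / δ) (ae_of_all _ fun a => ?_)
    rw [Real.norm_of_nonneg (one_div_pos.2 (hq0 a)).le]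
    exact one_div_le_one_div_of_le hδ (hqδ a)
  set m' := m.withDensity fun a => ENNReal.ofReal (1 / q a) with hm'
  have : IsFiniteMeasure m' := isFiniteMeasure_withDensity_ofReal hint.2
  have hfm : Measurable fun z : Ω × ℝ => z.2 * q z.1 := by fun_prop
  set ν := (m'.prod E).map fun z => z.2 * q z.1 with hνdef
  have hν : ∀ᵐ x ∂ν, 0 ≤ x := by
    refine (ae_map_iff hfm.aemeasurable measurableSet_Ici).2 ?_
    filter_upwards [Measure.quasiMeasurePreserving_snd.ae hE0] with z h2
    exact mul_nonneg h2 (hq0 _).le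
  obtain ⟨I, hI, hI0, hIl⟩ := exists_compoundPoisson ν hν
  have hL : ∀ l : ℝ, 0 ≤ l →
      ∫ x, Real.exp (-(l * x)) ∂ν = ∫ a, 1 / q a * (1 / (1 + l * q a)) ∂m := by
    intro l hl
    have hi := integrable_exp_neg_mul_of_nonneg hν hl
    rw [hνdef, integrable_map_measure (by fun_prop) hfm.aemeasurable] at hi
    rw [hνdef, integral_map hfm.aemeasurable (by fun_prop)]
    refine (integral_prod _ hi).trans ?_
    rw [hm',
      integral_withDensity_eq_integral_toReal_smul hwm (by simp)]
    refine integral_congr_ae (ae_of_all _ fun a => ?_)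
    simp only
    rw [ENNReal.toReal_ofReal (one_div_pos.2 (hq0 a)).le, smul_eq_mul,
      ← hEl _ (mul_nonneg hl (hq0 a).le)]
    congr 2
    ext y
    simp only [Function.comp_apply]
    ring_nf
  have hmass : ν.real univ = ∫ a, 1 / q a ∂m := by
    have := hL 0 le_rfl
    simpa using this
  refine ⟨I, hI, hI0, fun l hl => ?_⟩
  rw [hIl l hl, hmass, hL l hl]
  have hpos : ∀ a, 1 ≤ 1 + l * q a := fun a => by
    have := mul_nonneg hl (hq0 a).le
    linarith
  rw [← integral_sub _ hint, ← integral_neg]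
  · congr 2
    ext a
    have h1 := (hq0 a).ne'
    have h2 := (zero_lt_one.trans_le (hpos a)).ne'
    rw [← mul_sub_one, div_sub_one h2, sub_add_cancel_left, neg_div, mul_neg, neg_inj,
      mul_comm l (q a), mul_div_assoc, ← mul_assoc, one_div_mul_cancel h1, one_mul]
  · refine hint.mono (by fun_prop) (ae_of_all _ fun a => ?_)
    rw [norm_mul]
    refine mul_le_of_le_one_right (norm_nonneg _) ?_
    rw [Real.norm_of_nonneg (one_div_nonneg.2 (zero_le_one.trans (hpos a)))]
    exact (div_le_one (zero_lt_one.trans_le (hpos a))).2 (hpos a)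

/-- Laplace transforms of laws on the half-line that are uniformly `≥ 1 - K * l` are stable under
pointwise limits. -/
lemma exists_law_of_tendsto_laplace (μ : ℕ → ProbabilityMeasure ℝ)
    (hμ : ∀ n, ∀ᵐ x ∂(μ n : Measure ℝ), 0 ≤ x) {K : ℝ} (hK : 0 ≤ K) (L : ℝ → ℝ)
    (hbd : ∀ n, ∀ l, 0 ≤ l → 1 - K * l ≤ ∫ x, Real.exp (-(l * x)) ∂(μ n : Measure ℝ))
    (hlim : ∀ l, 0 ≤ l →
      Tendsto (fun n => ∫ x, Real.exp (-(l * x)) ∂(μ n : Measure ℝ)) atTop (nhds (L l))) :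
    ∃ I : Measure ℝ, IsProbabilityMeasure I ∧ (∀ᵐ x ∂I, 0 ≤ x) ∧
      ∀ l : ℝ, 0 ≤ l → ∫ x, Real.exp (-(l * x)) ∂I = L l := by
  have he : Real.exp (-1) < 1 := Real.exp_lt_one_iff.2 (by norm_num)
  have hd : 0 < 1 - Real.exp (-1) := by linarith
  set c : ℝ := K / (1 - Real.exp (-1)) with hc
  have hc0 : 0 ≤ c := by positivity
  have htail : ∀ n (j : ℕ), (μ n : Measure ℝ).real (Icc 0 ((j : ℝ) + 1))ᶜ ≤ c * (1 / ((j : ℝ) + 1)) := by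
    intro n j
    have hj : (0 : ℝ) < (j : ℝ) + 1 := by positivity
    have hb := hbd n (1 / ((j : ℝ) + 1)) (by positivity)
    have hi := integrable_exp_neg_mul_of_nonneg (hμ n) (one_div_pos.2 hj).le
    have h1 : ∫ x, (Icc 0 ((j : ℝ) + 1))ᶜ.indicator (fun _ => 1 - Real.exp (-1)) x ∂(μ n : Measure ℝ)
        ≤ ∫ x, (1 - Real.exp (-(1 / ((j : ℝ) + 1) * x))) ∂(μ n : Measure ℝ) := by
      refine integral_mono_ae ((integrable_const _).indicator measurableSet_Icc.compl)
        ((integrable_const _).sub hi) ((hμ n).mono fun x hx => ?_)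
      by_cases hxR : x ≤ (j : ℝ) + 1
      · have : x ∉ (Icc 0 ((j : ℝ) + 1))ᶜ := fun h => h ⟨hx, hxR⟩
        simp only [indicator_of_notMem this, sub_nonneg, Real.exp_le_one_iff]
        have : 0 ≤ 1 / ((j : ℝ) + 1) * x := by positivity
        linarith
      · have : x ∈ (Icc 0 ((j : ℝ) + 1))ᶜ := fun h => hxR h.2
        simp only [indicator_of_mem this]
        have h3 : 1 ≤ 1 / ((j : ℝ) + 1) * x := by
          rw [one_div, inv_mul_eq_div, one_le_div hj]
          exact (not_le.1 hxR).le
        gcongr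
    rw [integral_indicator_const _ measurableSet_Icc.compl, integral_sub (integrable_const _) hi,
      integral_const, smul_eq_mul] at h1
    simp only [probReal_univ, one_smul] at h1
    rw [hc, div_mul_eq_mul_div, le_div_iff₀ hd]
    linarith
  have hu : Tendsto (fun j : ℕ => Real.toNNReal (c * (1 / ((j : ℝ) + 1)))) atTop (nhds 0) := by
    have := (tendsto_one_div_add_atTop_nhds_zero_nat (𝕜 := ℝ)).const_mul c
    rw [mul_zero] at this
    simpa [Function.comp_def] using (continuous_real_toNNReal.tendsto 0).comp this
  have hcomp := isCompact_setOfPred_probabilityMeasure_mass_eq_compl_isCompact_le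
    (K := fun j : ℕ => Icc (0 : ℝ) ((j : ℝ) + 1)) hu (fun j => isCompact_Icc)
    (Or.inl inferInstance)
  obtain ⟨I, hImem, hIlim⟩ := hcomp.ultrafilter_le_nhds ((hyperfilter ℕ).map μ) (by
    rw [le_principal_iff]
    refine Filter.mem_map.2 (univ_mem' fun n j => ?_)
    rw [← NNReal.coe_le_coe, Real.coe_toNNReal _ (by positivity)]
    exact htail n j)
  have hI0 : ∀ᵐ x ∂(I : Measure ℝ), 0 ≤ x := by
    have hle : ∀ j : ℕ, I {x : ℝ | ¬ 0 ≤ x} ≤ Real.toNNReal (c * (1 / ((j : ℝ) + 1))) :=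
      fun j => by
        have hss : {x : ℝ | ¬ 0 ≤ x} ⊆ (Icc 0 ((j : ℝ) + 1))ᶜ := fun x hx h => hx h.1
        exact (I.apply_mono hss).trans (hImem j)
    have h0 : I {x : ℝ | ¬ 0 ≤ x} = 0 := le_antisymm (ge_of_tendsto' hu hle) zero_le
    rw [ae_iff]
    exact (ProbabilityMeasure.null_iff_toMeasure_null I _).1 h0
  refine ⟨I, inferInstance, hI0, fun l hl => ?_⟩
  have hbc : ∀ x : ℝ, ‖Real.exp (-(l * max x 0))‖ ≤ 1 := fun x => by
    rw [Real.norm_of_nonneg (Real.exp_pos _).le, Real.exp_le_one_iff]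
    nlinarith [mul_nonneg hl (le_max_right x 0)]
  let f : BoundedContinuousFunction ℝ ℝ :=
    BoundedContinuousFunction.ofNormedAddCommGroup (fun x => Real.exp (-(l * max x 0)))
      (by fun_prop) 1 hbc
  have hf : ∀ J : Measure ℝ, (∀ᵐ x ∂J, 0 ≤ x) → ∫ x, f x ∂J = ∫ x, Real.exp (-(l * x)) ∂J :=
    fun J hJ => integral_congr_ae (hJ.mono fun x hx => by
      simp [f, max_eq_left hx])
  have ht : Tendsto μ (hyperfilter ℕ) (nhds I) := hIlim
  have h1 := ProbabilityMeasure.tendsto_iff_forall_integral_tendsto.1 ht f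
  rw [hf _ hI0] at h1
  simp_rw [fun n => hf _ (hμ n)] at h1
  exact tendsto_nhds_unique h1 ((hlim l hl).mono_left Nat.hyperfilter_le_atTop)

/-- Infinitely divisible law whose Laplace exponent is a mixture of `l / (1 + l * q)`. -/
lemma exists_law_of_nonneg {Ω : Type*} [MeasurableSpace Ω] (m : Measure Ω) [IsFiniteMeasure m]
    {q : Ω → ℝ} (hq : Measurable q) (hq0 : ∀ a, 0 ≤ q a) :
    ∃ I : Measure ℝ, IsProbabilityMeasure I ∧ (∀ᵐ x ∂I, 0 ≤ x) ∧
      ∀ l : ℝ, 0 ≤ l → ∫ x, Real.exp (-(l * x)) ∂I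
        = Real.exp (-∫ a, l / (1 + l * q a) ∂m) := by
  have hε : ∀ n : ℕ, (0 : ℝ) < 1 / ((n : ℝ) + 1) := fun n => by positivity
  choose μ hμp hμ0 hμl using fun n : ℕ => exists_law_of_le m
    (q := fun a => q a + 1 / ((n : ℝ) + 1)) (by fun_prop) (hε n)
    (fun a => le_add_of_nonneg_left (hq0 a))
  have hle : ∀ (r : ℝ), 0 ≤ r → ∀ l, 0 ≤ l → ‖l / (1 + l * r)‖ ≤ l := fun r hr l hl => by
    have := mul_nonneg hl hr
    rw [Real.norm_of_nonneg (by positivity)]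
    exact div_le_self hl (by linarith)
  refine exists_law_of_tendsto_laplace (fun n => ⟨μ n, hμp n⟩) hμ0 (K := m.real univ)
    measureReal_nonneg _ (fun n l hl => ?_) fun l hl => ?_
  · simp only [ProbabilityMeasure.coe_mk]
    rw [hμl n l hl]
    refine le_trans ?_ (Real.one_sub_le_exp_neg _)
    have h := norm_integral_le_of_norm_le_const (μ := m) (ae_of_all _ fun a =>
      hle (q a + 1 / ((n : ℝ) + 1)) (add_nonneg (hq0 a) (hε n).le) l hl)
    have := (Real.le_norm_self _).trans h
    linarith
  · simp only [ProbabilityMeasure.coe_mk, fun n => hμl n l hl]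
    refine (Real.continuous_exp.tendsto _).comp (Tendsto.neg ?_)
    refine tendsto_integral_of_dominated_convergence (fun _ => l) (fun n => ?_)
      (integrable_const l) (fun n => ae_of_all _ fun a =>
        hle _ (add_nonneg (hq0 a) (hε n).le) l hl) (ae_of_all _ fun a => ?_)
    · exact Measurable.aestronglyMeasurable (by fun_prop)
    · have h1 : Tendsto (fun n : ℕ => q a + 1 / ((n : ℝ) + 1)) atTop (nhds (q a)) := by
        simpa using (tendsto_one_div_add_atTop_nhds_zero_nat (𝕜 := ℝ)).const_add (q a)
      have := mul_nonneg hl (hq0 a)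
      exact tendsto_const_nhds.div ((h1.const_mul l).const_add 1) (by positivity)

/-- A function that is right-continuous on an open interval is a.e. measurable there. -/
lemma aemeasurable_Ioo_of_continuousWithinAt_Ici {f : ℝ → ℝ} {s t : ℝ}
    (hf : ∀ x ∈ Ioo s t, ContinuousWithinAt f (Ici x) x) :
    AEMeasurable f (volume.restrict (Ioo s t)) := by
  have hpos : ∀ n : ℕ, (0 : ℝ) < (n : ℝ) + 1 := fun n => by positivity
  refine aemeasurable_of_tendsto_metrizable_ae atTop
    (f := fun (n : ℕ) (x : ℝ) => f (((⌊((n : ℝ) + 1) * x⌋ : ℝ) + 1) / ((n : ℝ) + 1)))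
    (fun n => ?_) ((ae_restrict_mem measurableSet_Ioo).mono fun x hx => ?_)
  · have h : Measurable fun k : ℤ => f (((k : ℝ) + 1) / ((n : ℝ) + 1)) := measurable_from_top
    exact (h.comp (Int.measurable_floor.comp (measurable_const_mul _))).aemeasurable
  · refine (hf x hx).tendsto.comp (tendsto_nhdsWithin_iff.2 ⟨?_, Eventually.of_forall fun n => ?_⟩)
    · have hu : Tendsto (fun n : ℕ => x + 1 / ((n : ℝ) + 1)) atTop (nhds x) := by
        simpa using (tendsto_one_div_add_atTop_nhds_zero_nat (𝕜 := ℝ)).const_add x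
      refine tendsto_of_tendsto_of_tendsto_of_le_of_le tendsto_const_nhds hu
        (fun n => ?_) (fun n => ?_)
      · rw [le_div_iff₀ (hpos n), mul_comm]
        exact (Int.lt_floor_add_one _).le
      · have := Int.floor_le (((n : ℝ) + 1) * x)
        have := (hpos n).ne'
        simp only
        rw [div_le_iff₀ (hpos n), add_mul x, one_div_mul_cancel this]
        linarith
    · rw [mem_Ici, le_div_iff₀ (hpos n), mul_comm]
      exact (Int.lt_floor_add_one _).le

lemma continuous_integral_left {f : ℝ → ℝ} (hf : Continuous f) (t : ℝ) :
    Continuous fun v => ∫ u in v..t, f u := by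
  simp_rw [fun v => intervalIntegral.integral_symm (μ := volume) (f := f) t v]
  exact (intervalIntegral.continuous_primitive (fun a b => hf.intervalIntegrable a b) t).neg

lemma continuous_Bf {β : ℝ → ℝ} (hβ : Continuous β) (t : ℝ) : Continuous fun v => Bf β v t :=
  Real.continuous_exp.comp (continuous_integral_left hβ t).neg

lemma continuous_Cf_integrand {σ β : ℝ → ℝ} (hσ : Continuous σ) (hβ : Continuous β) :
    Continuous fun v => σ v ^ 2 / 2 * Real.exp (∫ u in (0 : ℝ)..v, β u) :=
  ((hσ.pow 2).div_const 2).mul (Real.continuous_exp.comp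
    (intervalIntegral.continuous_primitive (fun a b => hβ.intervalIntegrable a b) 0))

lemma continuous_Cf {σ β : ℝ → ℝ} (hσ : Continuous σ) (hβ : Continuous β) (t : ℝ) :
    Continuous fun v => Cf σ β v t :=
  continuous_integral_left (continuous_Cf_integrand hσ hβ) t

lemma Cf_pos_s15 {σ β : ℝ → ℝ} (hσ : Continuous σ) (hβ : Continuous β) (hσ0 : ∀ x, 0 < σ x)
    {v t : ℝ} (h : v < t) : 0 < Cf σ β v t :=
  intervalIntegral.intervalIntegral_pos_of_pos
    ((continuous_Cf_integrand hσ hβ).intervalIntegrable v t)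
    (fun x => mul_pos (half_pos (pow_pos (hσ0 x) 2)) (Real.exp_pos _)) h

lemma Bf_mul_Bf {β : ℝ → ℝ} (hβ : Continuous β) (r v t : ℝ) :
    Bf β r v * Bf β v t = Bf β r t := by
  unfold Bf
  rw [← Real.exp_add, ← intervalIntegral.integral_add_adjacent_intervals
    (hβ.intervalIntegrable r v) (hβ.intervalIntegrable v t), neg_add]

lemma Psi_eq {σ β : ℝ → ℝ} (hσ : Continuous σ) (hβ : Continuous β) (hσ0 : ∀ x, 0 < σ x)
    {v t : ℝ} (h : v < t) {l : ℝ} (hl : 0 ≤ l) :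
    Psi σ β v t l = Bf β v t * (l / (1 + l * (Bf β 0 t * Cf σ β v t))) := by
  have hC := Cf_pos_s15 hσ hβ hσ0 h
  have h1 : 0 < Bf β 0 v := Real.exp_pos _
  have h2 : 0 < Bf β v t := Real.exp_pos _
  unfold Psi gf pf
  rw [← Bf_mul_Bf hβ 0 v t]
  have h3 : 0 < 1 + l * (Bf β 0 v * Bf β v t * Cf σ β v t) := by positivity
  have h4 : 0 < 1 / (Bf β 0 v * Bf β v t * Cf σ β v t) + l := by positivity
  rw [← mul_div_assoc, div_eq_div_iff h4.ne' h3.ne']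
  field_simp

lemma Psi_congr {σ β σ' β' : ℝ → ℝ} (hσ : ∀ x, 0 ≤ x → σ x = σ' x)
    (hβ : ∀ x, 0 ≤ x → β x = β' x) {v t : ℝ} (hv : 0 ≤ v) (hvt : v ≤ t) (l : ℝ) :
    Psi σ β v t l = Psi σ' β' v t l := by
  have hI : ∀ x, 0 ≤ x → ∫ u in (0 : ℝ)..x, β u = ∫ u in (0 : ℝ)..x, β' u := fun x hx =>
    intervalIntegral.integral_congr fun u hu => hβ u (by rw [uIcc_of_le hx] at hu; exact hu.1)
  have hC : Cf σ β v t = Cf σ' β' v t :=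
    intervalIntegral.integral_congr fun u hu => by
      rw [uIcc_of_le hvt] at hu
      have hu0 := hv.trans hu.1
      simp only [hσ u hu0, hI u hu0]
  unfold Psi gf pf Bf
  rw [hC, hI v hv, hI t (hv.trans hvt)]

lemma exists_law_of_continuous {σ β α : ℝ → ℝ} (hσ : Continuous σ) (hβ : Continuous β)
    (hσ0 : ∀ x, 0 < σ x) {s t M : ℝ} (hst : s < t) (hα0 : ∀ x ∈ Ioo s t, 0 ≤ α x)
    (hαc : ∀ x ∈ Ioo s t, ContinuousWithinAt α (Ici x) x) (hαM : ∀ x ∈ Ioo s t, α x ≤ M) :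
    ∃ I : Measure ℝ, IsProbabilityMeasure I ∧ (∀ᵐ x ∂I, 0 ≤ x) ∧
      ∀ l : ℝ, 0 ≤ l → ∫ x, Real.exp (-(l * x)) ∂I
        = Real.exp (-∫ v in s..t, σ v ^ 2 / 2 * α v * Psi σ β v t l) := by
  have hα := aemeasurable_Ioo_of_continuousWithinAt_Ici hαc
  have hg : Continuous fun v => σ v ^ 2 / 2 * Bf β v t :=
    ((hσ.pow 2).div_const 2).mul (continuous_Bf hβ t)
  have hgi : Integrable (fun v => σ v ^ 2 / 2 * Bf β v t) (volume.restrict (Ioo s t)) :=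
    (hg.continuousOn.integrableOn_compact isCompact_Icc).mono_set Ioo_subset_Icc_self
  have hwi : Integrable (fun v => α v * (σ v ^ 2 / 2 * Bf β v t)) (volume.restrict (Ioo s t)) :=
    hgi.bdd_mul hα.aestronglyMeasurable (c := M)
      ((ae_restrict_mem measurableSet_Ioo).mono fun x hx => by
        rw [Real.norm_of_nonneg (hα0 x hx)]
        exact hαM x hx)
  have := isFiniteMeasure_withDensity_ofReal hwi.2
  have hq : Continuous fun v => max (Bf β 0 t * Cf σ β v t) 0 :=
    (continuous_const.mul (continuous_Cf hσ hβ t)).max continuous_const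
  obtain ⟨I, hI, hI0, hIl⟩ := exists_law_of_nonneg
    ((volume.restrict (Ioo s t)).withDensity
      fun v => ENNReal.ofReal (α v * (σ v ^ 2 / 2 * Bf β v t)))
    hq.measurable (fun v => le_max_right _ _)
  refine ⟨I, hI, hI0, fun l hl => ?_⟩
  rw [hIl l hl, integral_withDensity_eq_integral_toReal_smul₀
    hwi.aestronglyMeasurable.aemeasurable.ennreal_ofReal (by simp),
    intervalIntegral.integral_of_le hst.le, integral_Ioc_eq_integral_Ioo]
  congr 2
  refine setIntegral_congr_fun measurableSet_Ioo fun v hv => ?_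
  have hB : 0 < Bf β v t := Real.exp_pos _
  have hB0 : 0 < Bf β 0 t := Real.exp_pos _
  have hαv := hα0 v hv
  have hC := Cf_pos_s15 hσ hβ hσ0 hv.2
  rw [ENNReal.toReal_ofReal (by positivity), Psi_eq hσ hβ hσ0 hv.2 hl,
    max_eq_left (by positivity), smul_eq_mul]
  ring

/-- For `α` nonnegative, right-continuous and bounded, and `0 ≤ s < t`, there exists a
probability measure `I_{s,t}` on `[0,∞)` with Laplace transform
`λ ↦ exp(−∫_s^t (σ²(v)/2)·α(v)·Ψ_{v,t}(λ) dv)`. -/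
theorem stmt_15 (σ β : ℝ → ℝ)
    (hσc : ContinuousOn σ (Set.Ici 0)) (hβc : ContinuousOn β (Set.Ici 0))
    (hσpos : ∀ x ∈ Set.Ici (0:ℝ), 0 < σ x) (hβnn : ∀ x ∈ Set.Ici (0:ℝ), 0 ≤ β x)
    (α : ℝ → ℝ) (hαnn : ∀ x ∈ Set.Ici (0:ℝ), 0 ≤ α x)
    (hαrc : ∀ x ∈ Set.Ici (0:ℝ), ContinuousWithinAt α (Set.Ici x) x)
    (M : ℝ) (hαbd : ∀ x ∈ Set.Ici (0:ℝ), α x ≤ M)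
    (s t : ℝ) (hs : 0 ≤ s) (hst : s < t) :
    ∃ I : Measure ℝ, IsProbabilityMeasure I ∧ I (Set.Ici (0:ℝ))ᶜ = 0 ∧
      ∀ l : ℝ, 0 ≤ l →
        (∫ x, Real.exp (-(l * x)) ∂I) =
          Real.exp (-∫ v in s..t, σ v ^ 2 / 2 * α v * Psi σ β v t l) := by
  have hm : Continuous fun x : ℝ => max x 0 := continuous_id.max continuous_const
  have hmem : ∀ x : ℝ, max x 0 ∈ Ici (0 : ℝ) := fun x => le_max_right x 0
  have hmax : ∀ (f : ℝ → ℝ) (x : ℝ), 0 ≤ x → f x = f (max x 0) := fun f x hx => by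
    rw [max_eq_left hx]
  have hsub : ∀ x ∈ Ioo s t, x ∈ Ici (0 : ℝ) := fun x hx => hs.trans hx.1.le
  obtain ⟨I, hI, hI0, hIl⟩ := exists_law_of_continuous (α := α) (M := M)
    (hσc.comp_continuous hm hmem) (hβc.comp_continuous hm hmem) (fun x => hσpos _ (hmem x)) hst
    (fun x hx => hαnn x (hsub x hx)) (fun x hx => hαrc x (hsub x hx))
    (fun x hx => hαbd x (hsub x hx))
  refine ⟨I, hI, hI0, fun l hl => ?_⟩
  rw [hIl l hl]
  congr 2
  refine intervalIntegral.integral_congr fun v hv => ?_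
  rw [uIcc_of_le hst.le] at hv
  have hv0 := hs.trans hv.1
  simp only [Psi_congr (hmax σ) (hmax β) hv0 hv.2 l, Function.comp_def, max_eq_left hv0]
end
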